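/- Under Condition (A) (nQ₁(n) = o(Q₂(n))), for any s₁, s₂ ∈ (0,1) and any integer sequence m = m(n) with 1 ≤ m(n) and m(n)/n → 0, one has lim_{n→∞} E[s₁^{Z₁(m,n)} s₂^{Z₂(m,n)} | Z(n) ≠ 0, Z(0)=e₂] = s₂. -/

import Mathlib

open MeasureTheory Filter Topology

/-- `a(n) ~ b(n)` : the ratio tends to `1` as `n → ∞`. -/
def Asymp (f g : ℕ → ℝ) : Prop :=
  Filter.Tendsto (fun n => f n / g n) Filter.atTop (nhds 1)

/-- A critical decomposable two-type Galton–Watson process together with its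
reduced process.  `P1` is the law of the process started from one particle of
type 1 (`Z(0) = e₁`), `P2` the law started from one particle of type 2
(`Z(0) = e₂`).  `Z1 n`/`Z2 n` are the numbers of particles of types 1 and 2 at
time `n`; `R1 m n`/`R2 m n` are the numbers of particles of types 1 and 2 alive
at time `m` having descendants at time `n` (the reduced process). -/
structure GWSetup where
  (Ω : Type)
  [mΩ : MeasurableSpace Ω]
  (P1 : Measure Ω)
  (P2 : Measure Ω)
  (hprob1 : IsProbabilityMeasure P1)
  (hprob2 : IsProbabilityMeasure P2)
  (Z1 : ℕ → Ω → ℕ)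
  (Z2 : ℕ → Ω → ℕ)
  (R1 : ℕ → ℕ → Ω → ℕ)
  (R2 : ℕ → ℕ → Ω → ℕ)
  (mZ1 : ∀ n, Measurable (Z1 n))
  (mZ2 : ∀ n, Measurable (Z2 n))
  (mR1 : ∀ m n, Measurable (R1 m n))
  (mR2 : ∀ m n, Measurable (R2 m n))
  (α1 : ℝ)
  (α2 : ℝ)
  (A21 : ℝ)
  (L1 : ℝ → ℝ)
  (L2 : ℝ → ℝ)
  (ρ : ℝ → ℝ → ℝ)
  (hα1 : 0 < α1 ∧ α1 ≤ 1)
  (hα2 : 0 < α2 ∧ α2 ≤ 1)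
  (hA21 : 0 < A21)
  -- initial states
  (hinit1 : ∀ᵐ ω ∂P1, Z1 0 ω = 1 ∧ Z2 0 ω = 0)
  (hinit2 : ∀ᵐ ω ∂P2, Z1 0 ω = 0 ∧ Z2 0 ω = 1)
  -- type-1 particles produce only type-1 particles
  (hdecomp : ∀ n, ∀ᵐ ω ∂P1, Z2 n ω = 0)
  -- criticality
  (hcrit1 : (∫ ω, (Z1 1 ω : ℝ) ∂P1) = 1)
  (hcrit2 : (∫ ω, (Z2 1 ω : ℝ) ∂P2) = 1)
  -- mean number of type-1 children of a type-2 particle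
  (hmean21 : (∫ ω, (Z1 1 ω : ℝ) ∂P2) = A21)
  -- assumption (F1)
  (hF1 : ∀ s : ℝ, 0 ≤ s → s < 1 →
    (∫ ω, s ^ Z1 1 ω ∂P1) = s + (1 - s) ^ (1 + α1) * L1 (1 - s))
  -- assumption (F2)
  (hF2 : ∀ s1 s2 : ℝ, 0 ≤ s1 → s1 ≤ 1 → 0 ≤ s2 → s2 < 1 →
    (∫ ω, s1 ^ Z1 1 ω * s2 ^ Z2 1 ω ∂P2) =
      s2 + (1 - s2) ^ (1 + α2) * L2 (1 - s2) - (A21 - ρ s1 s2) * (1 - s1))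
  -- `L1`, `L2` are slowly varying at `0`
  (hL1 : ∀ c : ℝ, 0 < c →
    Filter.Tendsto (fun x => L1 (c * x) / L1 x) (nhdsWithin 0 (Set.Ioi 0)) (nhds 1))
  (hL2 : ∀ c : ℝ, 0 < c →
    Filter.Tendsto (fun x => L2 (c * x) / L2 x) (nhdsWithin 0 (Set.Ioi 0)) (nhds 1))
  -- `ρ(s₁,s₂) → 0` as `s₁ s₂ ↑ 1`
  (hρ : ∀ ε : ℝ, 0 < ε → ∃ δ : ℝ, 0 < δ ∧ ∀ s1 s2 : ℝ,
    0 ≤ s1 → s1 ≤ 1 → 0 ≤ s2 → s2 ≤ 1 → 1 - δ < s1 * s2 → |ρ s1 s2| < ε)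
  -- branching (semigroup) property at the level of generating functions
  (hbranch1 : ∀ m n : ℕ, ∀ s : ℝ, 0 ≤ s → s ≤ 1 →
    (∫ ω, s ^ Z1 (m + n) ω ∂P1) = ∫ ω, (∫ ω', s ^ Z1 n ω' ∂P1) ^ Z1 m ω ∂P1)
  (hbranch2 : ∀ m n : ℕ, ∀ s1 s2 : ℝ, 0 ≤ s1 → s1 ≤ 1 → 0 ≤ s2 → s2 ≤ 1 →
    (∫ ω, s1 ^ Z1 (m + n) ω * s2 ^ Z2 (m + n) ω ∂P2) =
      ∫ ω, (∫ ω', s1 ^ Z1 n ω' ∂P1) ^ Z1 m ω *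
        (∫ ω', s1 ^ Z1 n ω' * s2 ^ Z2 n ω' ∂P2) ^ Z2 m ω ∂P2)
  -- the reduced process vanishes on the extinction event
  (hext : ∀ m n : ℕ, ∀ᵐ ω ∂P2,
    (Z1 n ω = 0 ∧ Z2 n ω = 0) → (R1 m n ω = 0 ∧ R2 m n ω = 0))
  -- the generating function of the reduced process (conditioning on `Z(m)`)
  (hreduced : ∀ m n : ℕ, m ≤ n → ∀ s1 s2 : ℝ, 0 ≤ s1 → s1 ≤ 1 → 0 ≤ s2 → s2 ≤ 1 →
    (∫ ω, s1 ^ R1 m n ω * s2 ^ R2 m n ω ∂P2) =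
      ∫ ω, (1 - (1 - s1) * (P1 {ω' | Z1 (n - m) ω' ≠ 0}).toReal) ^ Z1 m ω *
        (1 - (1 - s2) *
          (P2 {ω' | Z1 (n - m) ω' ≠ 0 ∨ Z2 (n - m) ω' ≠ 0}).toReal) ^ Z2 m ω ∂P2)

namespace GWSetup

variable (S : GWSetup)

/-- The survival event `{Z(n) ≠ 0}` (under the law `P2`). -/
def surv (n : ℕ) : Set S.Ω := {ω | S.Z1 n ω ≠ 0 ∨ S.Z2 n ω ≠ 0}

/-- `Q₁(n) = P(Z₁(n) > 0 | Z(0) = e₁)`. -/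
noncomputable def Q1 (n : ℕ) : ℝ := (S.P1 {ω | S.Z1 n ω ≠ 0}).toReal

/-- `Q₂(n) = P(Z₂(n) > 0 | Z(0) = e₂)`. -/
noncomputable def Q2 (n : ℕ) : ℝ := (S.P2 {ω | S.Z2 n ω ≠ 0}).toReal

/-- `Q₂₁(n) = P(Z(n) ≠ 0 | Z(0) = e₂)`. -/
noncomputable def Q21 (n : ℕ) : ℝ := (S.P2 (S.surv n)).toReal

/-- `F₁(n; s) = E[s^{Z₁(n)} | Z(0) = e₁]`. -/
noncomputable def F1 (n : ℕ) (s : ℝ) : ℝ := ∫ ω, s ^ S.Z1 n ω ∂S.P1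

/-- `F₂₁(n; s₁, s₂) = E[s₁^{Z₁(n)} s₂^{Z₂(n)} | Z(0) = e₂]`. -/
noncomputable def F21 (n : ℕ) (s1 s2 : ℝ) : ℝ :=
  ∫ ω, s1 ^ S.Z1 n ω * s2 ^ S.Z2 n ω ∂S.P2

/-- `Q₁(n; s) = 1 - F₁(n; s)`. -/
noncomputable def Q1s (n : ℕ) (s : ℝ) : ℝ := 1 - S.F1 n s

/-- `Q₂(n; s) = 1 - E[s^{Z₂(n)} | Z(0) = e₂]`. -/
noncomputable def Q2s (n : ℕ) (s : ℝ) : ℝ := 1 - S.F21 n 1 s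

/-- `Q₂₁(n; s₁, s₂) = 1 - F₂₁(n; s₁, s₂)`. -/
noncomputable def Q21s (n : ℕ) (s1 s2 : ℝ) : ℝ := 1 - S.F21 n s1 s2

/-- The conditional expectation
`E[f(Z₁(m,n), Z₂(m,n)) | Z(n) ≠ 0, Z(0) = e₂]` for the reduced process. -/
noncomputable def Ered (m n : ℕ) (f : ℕ → ℕ → ℝ) : ℝ :=
  (∫ ω in S.surv n, f (S.R1 m n ω) (S.R2 m n ω) ∂S.P2) / S.Q21 n

/-- The conditional probability `P(E | Z(n) ≠ 0, Z(0) = e₂)`. -/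
noncomputable def Pred (n : ℕ) (E : Set S.Ω) : ℝ :=
  (S.P2 (E ∩ S.surv n)).toReal / S.Q21 n

/-- The birth time `β_n` of the most recent common ancestor of the population
alive at time `n`:  `β_n = max {m < n : Z₁(m,n) + Z₂(m,n) = 1}`. -/
noncomputable def beta (n : ℕ) (ω : S.Ω) : ℕ :=
  sSup {m | m < n ∧ S.R1 m n ω + S.R2 m n ω = 1}

/-- The type `T_n` of the most recent common ancestor: the `i ∈ {1,2}` with
`Z_i(β_n, n) = 1`. -/
noncomputable def mrcaType (n : ℕ) (ω : S.Ω) : ℕ :=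
  if S.R2 (S.beta n ω) n ω = 1 then 2 else 1

/-- Condition (A): `n Q₁(n) = o(Q₂(n))`. -/
def CondA : Prop :=
  Filter.Tendsto (fun n : ℕ => (n : ℝ) * S.Q1 n / S.Q2 n) Filter.atTop (nhds 0)

/-- Condition (B): `Q₂(n) = o(n Q₁(n))`. -/
def CondB : Prop :=
  Filter.Tendsto (fun n : ℕ => S.Q2 n / ((n : ℝ) * S.Q1 n)) Filter.atTop (nhds 0)

/-- Condition (C): `n Q₁(n) ~ σ Q₂(n)`. -/
def CondC (σ : ℝ) : Prop := Asymp (fun n : ℕ => (n : ℝ) * S.Q1 n) (fun n => σ * S.Q2 n)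

/-- `h*` is an integer-valued function with
`(α₁ A₂₁ / (1 - α₁)) h*(n) Q₁(h*(n)) ~ Q₂(n)`. -/
def IsHStar (h : ℕ → ℕ) : Prop :=
  Asymp (fun n : ℕ => S.α1 * S.A21 / (1 - S.α1) * (h n : ℝ) * S.Q1 (h n)) S.Q2

/-- `g*` is an integer-valued function with `Q₂(g*(n)) ~ Q₂₁(n)`. -/
def IsGStar (g : ℕ → ℕ) : Prop := Asymp (fun n => S.Q2 (g n)) S.Q21

end GWSetup

/-- If `v` is an orbit of a map `h` on `[0,1]` whose relative decrement `1 - h y / y` is monotone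
and grows at least geometrically under doubling near `0`, then the relative decrement along the
orbit is `O(1/k)`. -/
lemma exists_mul_relDecrement_le {v φ : ℕ → ℝ} {y₀ lam : ℝ}
    (hpos : ∀ k, 0 < v k) (hφ0 : ∀ k, 0 ≤ φ k) (hφ1 : ∀ k, φ k ≤ 1)
    (hstep : ∀ k, v (k + 1) = v k * (1 - φ k)) (hmono : ∀ j k, j ≤ k → φ k ≤ φ j)
    (hlam : 1 < lam)
    (hdouble : ∀ j k, v k ≤ y₀ → 2 * v k ≤ v j → lam * φ k ≤ φ j)
    (hsmall : ∃ K, ∀ k, K ≤ k → v k ≤ y₀) :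
    ∃ C : ℝ, ∀ k : ℕ, (k : ℝ) * φ k ≤ C := by
  obtain ⟨K, hK⟩ := hsmall
  have hanti : Antitone v := antitone_nat_of_succ_le fun k => by
    rw [hstep]; nlinarith [hpos k, hφ0 k]
  have hdec : ∀ k j : ℕ, j ≤ k → ((k : ℝ) - j) * (v k * φ k) ≤ v j - v k := by
    intro k j hjk
    have key : ∀ d : ℕ, d ≤ k → (d : ℝ) * (v k * φ k) ≤ v (k - d) - v k := by
      intro d
      induction d with
      | zero => simp
      | succ d ih =>
        intro hd
        have h1 := ih (by omega)
        have h2 : k - d = (k - (d + 1)) + 1 := by omega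
        have h3 := hstep (k - (d + 1))
        rw [← h2] at h3
        have h4 : v k ≤ v (k - (d + 1)) := hanti (by omega)
        have h5 := hmono (k - (d + 1)) k (by omega)
        have h6 : v k * φ k ≤ v (k - (d + 1)) * φ (k - (d + 1)) :=
          mul_le_mul h4 h5 (hφ0 k) (hpos _).le
        push_cast
        nlinarith
    have := key (k - j) (Nat.sub_le _ _)
    rwa [Nat.sub_sub_self hjk, Nat.cast_sub hjk] at this
  have hl0 : 0 < 1 - lam⁻¹ := by
    have := inv_lt_one_of_one_lt₀ hlam
    linarith
  set C : ℝ := K + 2 / (1 - lam⁻¹) with hC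
  have h2pos : 0 < 2 / (1 - lam⁻¹) := by positivity
  have hC0 : 0 < C := by positivity
  have hC2 : C * lam⁻¹ + 2 ≤ C := by
    have : 2 / (1 - lam⁻¹) ≤ C := by rw [hC]; linarith [Nat.cast_nonneg (α := ℝ) K]
    rw [div_le_iff₀ hl0] at this
    linarith
  have hC1 : 1 ≤ C := by
    have : 0 < C * lam⁻¹ := by positivity
    linarith
  refine ⟨C, fun k => ?_⟩
  induction k using Nat.strong_induction_on with
  | _ k ih =>
    by_cases hkK : k ≤ K
    · have : (k : ℝ) ≤ K := by exact_mod_cast hkK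
      nlinarith [hφ0 k, hφ1 k, Nat.cast_nonneg (α := ℝ) k]
    have hky : v k ≤ y₀ := hK k (by omega)
    have hex : ∃ j, v j ≤ 2 * v k := ⟨k, by linarith [hpos k]⟩
    classical
    set j := Nat.find hex
    have hj1 : v j ≤ 2 * v k := Nat.find_spec hex
    have hjk : j ≤ k := Nat.find_min' hex (by linarith [hpos k])
    have hfirst : ((k : ℝ) - j) * φ k ≤ 1 := by
      have h := hdec k j hjk
      have h' : v k * (((k : ℝ) - j) * φ k) ≤ v k * 1 := by nlinarith
      exact le_of_mul_le_mul_left h' (hpos k)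
    rcases Nat.eq_zero_or_pos j with h0 | hjp
    · rw [h0] at hfirst
      simp only [Nat.cast_zero, sub_zero] at hfirst
      linarith
    · have hlt : 2 * v k < v (j - 1) := by
        have := Nat.find_min hex (m := j - 1) (by omega)
        linarith [not_le.1 this]
      have hd := hdouble (j - 1) k hky hlt.le
      have hih := ih (j - 1) (by omega)
      have hcast : ((j - 1 : ℕ) : ℝ) = j - 1 := by
        rw [Nat.cast_sub hjp]; simp
      have hj0 : (0 : ℝ) ≤ ((j - 1 : ℕ) : ℝ) := Nat.cast_nonneg _
      have h1 : ((j - 1 : ℕ) : ℝ) * φ k ≤ C * lam⁻¹ := by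
        rw [← div_eq_mul_inv, le_div_iff₀ (by linarith)]
        nlinarith
      rw [hcast] at h1
      nlinarith [hφ1 k]

/-- A positive sequence with relative decrements `O(1/k)` decays at most polynomially. -/
lemma exists_pow_mul_mono {v φ : ℕ → ℝ} {C : ℝ} (hpos : ∀ k, 0 < v k)
    (hstep : ∀ k, v (k + 1) = v k * (1 - φ k)) (hφ : ∀ k : ℕ, (k : ℝ) * φ k ≤ C) :
    ∃ p K : ℕ, 1 ≤ K ∧ ∀ j n : ℕ, K ≤ j → j ≤ n → (j : ℝ) ^ p * v j ≤ (n : ℝ) ^ p * v n := by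
  obtain ⟨N, hN⟩ := exists_nat_ge C
  refine ⟨2 * N, 2 * N + 1, by omega, fun j n hj hjn => ?_⟩
  induction n, hjn using Nat.le_induction with
  | base => exact le_rfl
  | succ n hn ih =>
    refine ih.trans ?_
    have hnN : (2 * N + 1 : ℝ) ≤ n := by exact_mod_cast hj.trans hn
    have hn0 : (0 : ℝ) < n := by linarith [Nat.cast_nonneg (α := ℝ) N]
    have hφn : φ n ≤ N / n := by
      rw [le_div_iff₀ hn0]; linarith [hφ n]
    have hbern : 1 + ((2 * N : ℕ) : ℝ) * (1 / n) ≤ (1 + 1 / (n : ℝ)) ^ (2 * N) :=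
      one_add_mul_le_pow (by have : 0 ≤ 1 / (n : ℝ) := by positivity
                             linarith) _
    have hN1 : (0 : ℝ) ≤ 1 - N / n := by
      rw [sub_nonneg, div_le_one hn0]; linarith [Nat.cast_nonneg (α := ℝ) N]
    have hprod : (1 : ℝ) ≤ (1 + ((2 * N : ℕ) : ℝ) * (1 / n)) * (1 - N / n) := by
      have h : (1 + ((2 * N : ℕ) : ℝ) * (1 / n)) * (1 - N / n) - 1
          = N * (n - 2 * N) / n ^ 2 := by
        push_cast; field_simp; ring
      have : 0 ≤ (N : ℝ) * (n - 2 * N) / n ^ 2 := by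
        apply div_nonneg (mul_nonneg (Nat.cast_nonneg _) (by linarith)) (by positivity)
      linarith
    have hge : (1 : ℝ) ≤ (1 + 1 / (n : ℝ)) ^ (2 * N) * (1 - φ n) := by
      refine hprod.trans (mul_le_mul hbern (by linarith) hN1 (by positivity))
    have heq : ((n + 1 : ℕ) : ℝ) = n * (1 + 1 / (n : ℝ)) := by
      push_cast; field_simp
    rw [hstep, heq, mul_pow]
    have hp : 0 < (n : ℝ) ^ (2 * N) * v n := mul_pos (by positivity) (hpos n)
    nlinarith

namespace GWSetup

attribute [instance] mΩ hprob1 hprob2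

variable (S : GWSetup)

lemma integrable_pow_Z1 (n : ℕ) {s : ℝ} (h0 : 0 ≤ s) (h1 : s ≤ 1) :
    Integrable (fun ω => s ^ S.Z1 n ω) S.P1 := by
  refine Integrable.of_bound (C := 1)
    ((measurable_from_nat (f := fun k => s ^ k)).comp (S.mZ1 n)).aestronglyMeasurable ?_
  refine ae_of_all _ fun ω => ?_
  rw [Real.norm_of_nonneg (by positivity)]
  exact pow_le_one₀ h0 h1

lemma integrable_pow_mul_pow {X Y : S.Ω → ℕ} (hX : Measurable X) (hY : Measurable Y)
    {s t : ℝ} (hs0 : 0 ≤ s) (hs1 : s ≤ 1) (ht0 : 0 ≤ t) (ht1 : t ≤ 1) :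
    Integrable (fun ω => s ^ X ω * t ^ Y ω) S.P2 := by
  refine Integrable.of_bound (C := 1)
    (((measurable_from_nat (f := fun k => s ^ k)).comp hX).mul
      ((measurable_from_nat (f := fun k => t ^ k)).comp hY)).aestronglyMeasurable ?_
  refine ae_of_all _ fun ω => ?_
  rw [Real.norm_of_nonneg (by positivity)]
  exact mul_le_one₀ (pow_le_one₀ hs0 hs1) (by positivity) (pow_le_one₀ ht0 ht1)

lemma integrable_F21 (n : ℕ) {s t : ℝ} (hs0 : 0 ≤ s) (hs1 : s ≤ 1) (ht0 : 0 ≤ t) (ht1 : t ≤ 1) :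
    Integrable (fun ω => s ^ S.Z1 n ω * t ^ S.Z2 n ω) S.P2 :=
  S.integrable_pow_mul_pow (S.mZ1 n) (S.mZ2 n) hs0 hs1 ht0 ht1

lemma F21_nonneg (n : ℕ) {s t : ℝ} (hs0 : 0 ≤ s) (ht0 : 0 ≤ t) : 0 ≤ S.F21 n s t :=
  integral_nonneg fun ω => by positivity

lemma F21_mono (n : ℕ) {s s' t t' : ℝ} (hs0 : 0 ≤ s) (hs : s ≤ s') (hs1 : s' ≤ 1)
    (ht0 : 0 ≤ t) (ht : t ≤ t') (ht1 : t' ≤ 1) : S.F21 n s t ≤ S.F21 n s' t' := by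
  refine integral_mono (S.integrable_F21 n hs0 (hs.trans hs1) ht0 (ht.trans ht1))
    (S.integrable_F21 n (hs0.trans hs) hs1 (ht0.trans ht) ht1) fun ω => ?_
  have := hs0.trans hs
  dsimp only
  gcongr

lemma F21_one_one (n : ℕ) : S.F21 n 1 1 = 1 := by simp [F21]

lemma F21_le_one (n : ℕ) {s t : ℝ} (hs0 : 0 ≤ s) (hs1 : s ≤ 1) (ht0 : 0 ≤ t) (ht1 : t ≤ 1) :
    S.F21 n s t ≤ 1 :=
  (S.F21_mono n hs0 hs1 le_rfl ht0 ht1 le_rfl).trans_eq (S.F21_one_one n)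

lemma F1_nonneg (n : ℕ) {s : ℝ} (hs0 : 0 ≤ s) : 0 ≤ S.F1 n s :=
  integral_nonneg fun ω => by positivity

lemma F1_le_one (n : ℕ) {s : ℝ} (hs0 : 0 ≤ s) (hs1 : s ≤ 1) : S.F1 n s ≤ 1 := by
  have := integral_mono (S.integrable_pow_Z1 n hs0 hs1) (integrable_const (1 : ℝ))
    fun ω => pow_le_one₀ (n := S.Z1 n ω) hs0 hs1
  simpa [F1] using this

lemma F1_one (n : ℕ) : S.F1 n 1 = 1 := by simp [F1]

lemma F1_zero (s : ℝ) : S.F1 0 s = s := by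
  have : S.F1 0 s = ∫ _, s ∂S.P1 :=
    integral_congr_ae (S.hinit1.mono fun ω h => by simp [h.1])
  simpa using this

lemma F21_zero (s t : ℝ) : S.F21 0 s t = t := by
  have : S.F21 0 s t = ∫ _, t ∂S.P2 :=
    integral_congr_ae (S.hinit2.mono fun ω h => by simp [h.1, h.2])
  simpa using this

lemma F1_succ (n : ℕ) {s : ℝ} (h0 : 0 ≤ s) (h1 : s ≤ 1) :
    S.F1 (n + 1) s = S.F1 1 (S.F1 n s) := by
  rw [add_comm]; exact S.hbranch1 1 n s h0 h1

lemma F21_add (m n : ℕ) {s t : ℝ} (hs0 : 0 ≤ s) (hs1 : s ≤ 1) (ht0 : 0 ≤ t) (ht1 : t ≤ 1) :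
    S.F21 (m + n) s t = S.F21 m (S.F1 n s) (S.F21 n s t) :=
  S.hbranch2 m n s t hs0 hs1 ht0 ht1

lemma F21_succ (n : ℕ) {s t : ℝ} (hs0 : 0 ≤ s) (hs1 : s ≤ 1) (ht0 : 0 ≤ t) (ht1 : t ≤ 1) :
    S.F21 (n + 1) s t = S.F21 1 (S.F1 n s) (S.F21 n s t) := by
  rw [add_comm]; exact S.F21_add 1 n hs0 hs1 ht0 ht1

lemma F21_one_succ (n : ℕ) {t : ℝ} (ht0 : 0 ≤ t) (ht1 : t ≤ 1) :
    S.F21 (n + 1) 1 t = S.F21 1 1 (S.F21 n 1 t) := by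
  rw [S.F21_succ n zero_le_one le_rfl ht0 ht1, F1_one]

lemma Q1_eq (n : ℕ) : S.Q1 n = 1 - S.F1 n 0 := by
  have hm : MeasurableSet {ω | S.Z1 n ω ≠ 0} := S.mZ1 n (MeasurableSet.of_discrete (s := {0}ᶜ))
  have h : S.F1 n 0 = ∫ ω, (1 - Set.indicator {ω | S.Z1 n ω ≠ 0} (fun _ => (1 : ℝ)) ω) ∂S.P1 := by
    refine integral_congr_ae (ae_of_all _ fun ω => ?_)
    by_cases hz : S.Z1 n ω = 0 <;> simp [hz, Set.indicator]
  rw [h, integral_sub (integrable_const _) ((integrable_const _).indicator hm),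
    integral_indicator hm]
  simp [Q1, Measure.real]

lemma measurableSet_surv (n : ℕ) : MeasurableSet (S.surv n) :=
  (S.mZ1 n (MeasurableSet.of_discrete (s := {0}ᶜ))).union
    (S.mZ2 n (MeasurableSet.of_discrete (s := {0}ᶜ)))

lemma Q21_eq (n : ℕ) : S.Q21 n = 1 - S.F21 n 0 0 := by
  have hm := S.measurableSet_surv n
  have h : S.F21 n 0 0 = ∫ ω, (1 - Set.indicator (S.surv n) (fun _ => (1 : ℝ)) ω) ∂S.P2 := by
    refine integral_congr_ae (ae_of_all _ fun ω => ?_)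
    by_cases hz : S.Z1 n ω = 0 <;> by_cases hz' : S.Z2 n ω = 0 <;>
      simp [hz, hz', Set.indicator, surv]
  rw [h, integral_sub (integrable_const _) ((integrable_const _).indicator hm),
    integral_indicator hm]
  simp [Q21, Measure.real]

lemma Q2_eq (n : ℕ) : S.Q2 n = 1 - S.F21 n 1 0 := by
  have hm : MeasurableSet {ω | S.Z2 n ω ≠ 0} := S.mZ2 n (MeasurableSet.of_discrete (s := {0}ᶜ))
  have h : S.F21 n 1 0 =
      ∫ ω, (1 - Set.indicator {ω | S.Z2 n ω ≠ 0} (fun _ => (1 : ℝ)) ω) ∂S.P2 := by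
    refine integral_congr_ae (ae_of_all _ fun ω => ?_)
    by_cases hz : S.Z2 n ω = 0 <;> simp [hz, Set.indicator]
  rw [h, integral_sub (integrable_const _) ((integrable_const _).indicator hm),
    integral_indicator hm]
  simp [Q2, Measure.real]

lemma integrable_Z1_P1 : Integrable (fun ω => (S.Z1 1 ω : ℝ)) S.P1 :=
  Integrable.of_integral_ne_zero (by rw [S.hcrit1]; exact one_ne_zero)

lemma integrable_Z2_P2 : Integrable (fun ω => (S.Z2 1 ω : ℝ)) S.P2 :=
  Integrable.of_integral_ne_zero (by rw [S.hcrit2]; exact one_ne_zero)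

lemma integrable_Z1_P2 : Integrable (fun ω => (S.Z1 1 ω : ℝ)) S.P2 :=
  Integrable.of_integral_ne_zero (by rw [S.hmean21]; exact S.hA21.ne')

lemma pow_sub_pow_le_mul {a b : ℝ} (ha : 0 ≤ a) (hab : a ≤ b) (hb : b ≤ 1) (k : ℕ) :
    b ^ k - a ^ k ≤ k * (b - a) := by
  induction k with
  | zero => simp
  | succ k ih =>
    have h1 : b ^ k ≤ 1 := pow_le_one₀ (ha.trans hab) hb
    have h2 : a ^ k ≤ b ^ k := pow_le_pow_left₀ ha hab k
    have h3 : 0 ≤ a ^ k := by positivity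
    push_cast
    rw [pow_succ, pow_succ]
    nlinarith

lemma le_F1_one {s : ℝ} (h0 : 0 ≤ s) (h1 : s ≤ 1) : s ≤ S.F1 1 s := by
  have h := integral_mono (μ := S.P1) (f := fun ω => 1 - (S.Z1 1 ω : ℝ) * (1 - s))
    (g := fun ω => s ^ S.Z1 1 ω)
    ((integrable_const _).sub (S.integrable_Z1_P1.mul_const _)) (S.integrable_pow_Z1 1 h0 h1)
    fun ω => by
      have := pow_sub_pow_le_mul h0 h1 le_rfl (S.Z1 1 ω)
      rw [one_pow] at this
      dsimp only
      linarith
  rw [integral_sub (integrable_const _) (S.integrable_Z1_P1.mul_const _), integral_mul_const,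
    S.hcrit1] at h
  simpa [F1] using h

lemma le_F1 (n : ℕ) {s : ℝ} (h0 : 0 ≤ s) (h1 : s ≤ 1) : s ≤ S.F1 n s := by
  induction n with
  | zero => rw [F1_zero]
  | succ n ih =>
    rw [S.F1_succ n h0 h1]
    exact ih.trans (S.le_F1_one (S.F1_nonneg n h0) (S.F1_le_one n h0 h1))

lemma F21_one_sub_le {a b : ℝ} (ha : 0 ≤ a) (hab : a ≤ b) (hb : b ≤ 1) :
    S.F21 1 1 b - S.F21 1 1 a ≤ b - a := by
  have ib := S.integrable_F21 1 zero_le_one le_rfl (ha.trans hab) hb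
  have ia := S.integrable_F21 1 zero_le_one le_rfl ha (hab.trans hb)
  have h := integral_mono (ib.sub ia) (S.integrable_Z2_P2.mul_const (b - a)) fun ω => by
    simpa using pow_sub_pow_le_mul ha hab hb (S.Z2 1 ω)
  rw [integral_mul_const, S.hcrit2, one_mul] at h
  simp only [Pi.sub_apply] at h
  rwa [integral_sub ib ia] at h

lemma F21_type1_sub_le {s t : ℝ} (hs0 : 0 ≤ s) (hs1 : s ≤ 1) (ht0 : 0 ≤ t) (ht1 : t ≤ 1) :
    S.F21 1 1 t - S.F21 1 s t ≤ S.A21 * (1 - s) := by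
  have ib := S.integrable_F21 1 zero_le_one le_rfl ht0 ht1
  have ia := S.integrable_F21 1 hs0 hs1 ht0 ht1
  have h := integral_mono (ib.sub ia) (S.integrable_Z1_P2.mul_const (1 - s)) fun ω => by
    have h1 := pow_sub_pow_le_mul hs0 hs1 le_rfl (S.Z1 1 ω)
    have h2 : t ^ S.Z2 1 ω ≤ 1 := pow_le_one₀ ht0 ht1
    have h3 : 0 ≤ t ^ S.Z2 1 ω := by positivity
    have h4 : s ^ S.Z1 1 ω ≤ 1 := pow_le_one₀ hs0 hs1
    simp only [Pi.sub_apply, one_pow] at h1 ⊢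
    nlinarith
  rw [integral_mul_const, S.hmean21] at h
  simp only [Pi.sub_apply] at h
  rwa [integral_sub ib ia] at h

/-- Type-1 particles change the generating function at time `m` by at most `m A₂₁ (1 - s)`. -/
lemma F21_one_sub_F21_le (m : ℕ) {s t : ℝ} (hs0 : 0 ≤ s) (hs1 : s ≤ 1) (ht0 : 0 ≤ t)
    (ht1 : t ≤ 1) : S.F21 m 1 t - S.F21 m s t ≤ m * S.A21 * (1 - s) := by
  induction m with
  | zero => simp [F21_zero]
  | succ m ih =>
    rw [S.F21_one_succ m ht0 ht1, S.F21_succ m hs0 hs1 ht0 ht1]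
    have hle := S.F21_mono m hs0 hs1 le_rfl ht0 le_rfl ht1
    have h0 := S.F21_nonneg m hs0 ht0
    have h1 := S.F21_le_one m zero_le_one le_rfl ht0 ht1
    have e1 := S.F21_one_sub_le h0 hle h1
    have e2 := S.F21_type1_sub_le (S.F1_nonneg m hs0) (S.F1_le_one m hs0 hs1) h0 (hle.trans h1)
    have e3 := S.le_F1 m hs0 hs1
    have e4 := S.hA21
    push_cast
    nlinarith

lemma le_F21_one (m : ℕ) {t : ℝ} (ht0 : 0 ≤ t) (ht1 : t ≤ 1) : t ≤ S.F21 m 1 t := by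
  induction m with
  | zero => rw [F21_zero]
  | succ m ih =>
    rw [S.F21_one_succ m ht0 ht1]
    have := S.F21_one_sub_le (S.F21_nonneg m zero_le_one ht0)
      (S.F21_le_one m zero_le_one le_rfl ht0 ht1) le_rfl
    rw [F21_one_one] at this
    linarith

lemma convex_pow_le {c t : ℝ} (hc0 : 0 ≤ c) (hc1 : c ≤ 1) (ht0 : 0 ≤ t) (k : ℕ) :
    (1 - c * (1 - t)) ^ k ≤ 1 - c * (1 - t ^ k) := by
  have h := (convexOn_pow k).2 (Set.mem_Ici.2 (zero_le_one (α := ℝ))) (Set.mem_Ici.2 ht0)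
    (sub_nonneg.2 hc1) hc0 (sub_add_cancel 1 c)
  simp only [smul_eq_mul, one_pow, mul_one] at h
  calc (1 - c * (1 - t)) ^ k = (1 - c + c * t) ^ k := by ring
    _ ≤ 1 - c + c * t ^ k := h
    _ = _ := by ring

lemma F21_one_convex (m : ℕ) {c t : ℝ} (hc0 : 0 ≤ c) (hc1 : c ≤ 1) (ht0 : 0 ≤ t) (ht1 : t ≤ 1) :
    S.F21 m 1 (1 - c * (1 - t)) ≤ 1 - c * (1 - S.F21 m 1 t) := by
  have it := S.integrable_F21 m zero_le_one le_rfl ht0 ht1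
  have ic : Integrable (fun ω => c * (1 - 1 ^ S.Z1 m ω * t ^ S.Z2 m ω)) S.P2 :=
    ((integrable_const (1 : ℝ)).sub it).const_mul c
  have hct : c * (1 - t) ≤ 1 := mul_le_one₀ hc1 (by linarith) (by linarith)
  have hct0 : 0 ≤ c * (1 - t) := mul_nonneg hc0 (by linarith)
  have h := integral_mono (S.integrable_F21 m zero_le_one le_rfl (t := 1 - c * (1 - t))
    (by linarith) (by linarith))
    ((integrable_const (1 : ℝ)).sub ic) fun ω => by
      simpa using convex_pow_le hc0 hc1 ht0 (S.Z2 m ω)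
  simp only [Pi.sub_apply] at h
  rw [integral_sub (integrable_const _) ic, integral_const_mul,
    integral_sub (integrable_const _) it] at h
  simpa [F21] using h

lemma Q2_one_pos : 0 < S.Q2 1 := by
  by_contra! hle
  have h0 : S.Q2 1 = 0 := le_antisymm hle ENNReal.toReal_nonneg
  have hz : S.P2 {ω | S.Z2 1 ω ≠ 0} = 0 := by
    rcases (ENNReal.toReal_eq_zero_iff _).1 h0 with h | h
    · exact h
    · exact absurd h (measure_ne_top _ _)
  have hae : (fun ω => (S.Z2 1 ω : ℝ)) =ᵐ[S.P2] fun _ => 0 := by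
    have : ∀ᵐ ω ∂S.P2, S.Z2 1 ω = 0 := by rwa [ae_iff]
    exact this.mono fun ω h => by simp [h]
  have := integral_congr_ae hae
  rw [S.hcrit2] at this
  simp at this

/-- The one-step map of the type-2 survival probabilities: `Q₂(n + 1) = h(Q₂(n))`. -/
noncomputable def stepQ2 (y : ℝ) : ℝ := 1 - S.F21 1 1 (1 - y)

lemma Q2_zero : S.Q2 0 = 1 := by rw [Q2_eq, F21_zero]; simp

lemma Q2_succ (n : ℕ) : S.Q2 (n + 1) = S.stepQ2 (S.Q2 n) := by
  rw [Q2_eq, S.F21_one_succ n le_rfl zero_le_one, stepQ2, Q2_eq, sub_sub_cancel]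

lemma Q2_le_one (n : ℕ) : S.Q2 n ≤ 1 := by
  rw [Q2_eq]; linarith [S.F21_nonneg n zero_le_one (le_refl (0 : ℝ))]

lemma mul_stepQ2_le {c y : ℝ} (hc0 : 0 ≤ c) (hc1 : c ≤ 1) (hy0 : 0 ≤ y) (hy1 : y ≤ 1) :
    c * S.stepQ2 y ≤ S.stepQ2 (c * y) := by
  have := S.F21_one_convex 1 hc0 hc1 (t := 1 - y) (by linarith) (by linarith)
  rw [sub_sub_cancel] at this
  unfold stepQ2
  linarith

lemma stepQ2_le {y : ℝ} (hy0 : 0 ≤ y) (hy1 : y ≤ 1) : S.stepQ2 y ≤ y := by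
  have := S.le_F21_one 1 (t := 1 - y) (by linarith) (by linarith)
  unfold stepQ2; linarith

lemma stepQ2_pos {y : ℝ} (hy0 : 0 < y) (hy1 : y ≤ 1) : 0 < S.stepQ2 y := by
  have h := S.mul_stepQ2_le hy0.le hy1 zero_le_one le_rfl
  have h1 := S.Q2_one_pos
  rw [S.Q2_succ 0, Q2_zero] at h1
  rw [mul_one] at h
  exact (mul_pos hy0 h1).trans_le h

lemma Q2_pos (n : ℕ) : 0 < S.Q2 n := by
  induction n with
  | zero => rw [Q2_zero]; exact one_pos
  | succ n ih => rw [Q2_succ]; exact S.stepQ2_pos ih (S.Q2_le_one n)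

/-- The relative decrement `1 - h(y) / y` of the one-step map. -/
noncomputable def relDec (y : ℝ) : ℝ := 1 - S.stepQ2 y / y

lemma relDec_nonneg {y : ℝ} (hy0 : 0 < y) (hy1 : y ≤ 1) : 0 ≤ S.relDec y := by
  rw [relDec, sub_nonneg, div_le_one hy0]
  exact S.stepQ2_le hy0.le hy1

lemma relDec_mono {x y : ℝ} (hx : 0 < x) (hxy : x ≤ y) (hy1 : y ≤ 1) :
    S.relDec x ≤ S.relDec y := by
  have hy := hx.trans_le hxy
  have h := S.mul_stepQ2_le (c := x / y) (by positivity) ((div_le_one hy).2 hxy) hy.le hy1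
  rw [div_mul_cancel₀ _ hy.ne'] at h
  refine sub_le_sub_left ?_ 1
  rw [le_div_iff₀ hx]
  calc S.stepQ2 y / y * x = x / y * S.stepQ2 y := by ring
    _ ≤ _ := h

lemma relDec_eq {y : ℝ} (hy0 : 0 < y) (hy1 : y ≤ 1) : S.relDec y = y ^ S.α2 * S.L2 y := by
  have h := S.hF2 1 (1 - y) zero_le_one le_rfl (by linarith) (by linarith)
  rw [sub_self, mul_zero, sub_zero, sub_sub_cancel, Real.rpow_add hy0, Real.rpow_one] at h
  have h' : S.F21 1 1 (1 - y) = 1 - y + y * y ^ S.α2 * S.L2 y := h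
  rw [relDec, stepQ2, h']
  field_simp
  ring

lemma exists_relDec_double : ∃ y₀ lam : ℝ, 0 < y₀ ∧ y₀ ≤ 1 ∧ 1 < lam ∧ 0 < S.relDec y₀ ∧
    ∀ y, 0 < y → y ≤ y₀ → 2 * y ≤ 1 → lam * S.relDec y ≤ S.relDec (2 * y) := by
  have h2 : (1 : ℝ) < 2 ^ S.α2 := Real.one_lt_rpow one_lt_two S.hα2.1
  obtain ⟨lam, hl1, hl2⟩ := exists_between h2
  have hlim : Tendsto (fun x => (2 : ℝ) ^ S.α2 * (S.L2 (2 * x) / S.L2 x)) (𝓝[>] 0)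
      (𝓝 (2 ^ S.α2 * 1)) := (S.hL2 2 two_pos).const_mul _
  have hev := hlim.eventually (lt_mem_nhds (by simpa using hl2))
  obtain ⟨u, hu0, hu⟩ := mem_nhdsGT_iff_exists_Ioc_subset.1 hev
  have hu0 : (0 : ℝ) < u := hu0
  have key : ∀ y, 0 < y → y ≤ u → 2 * y ≤ 1 →
      0 < S.relDec y ∧ lam * S.relDec y ≤ S.relDec (2 * y) := by
    intro y hy hyu hy2
    have hr : lam < 2 ^ S.α2 * (S.L2 (2 * y) / S.L2 y) := hu ⟨hy, hyu⟩
    have hne : S.L2 y ≠ 0 := fun h => by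
      rw [h, div_zero, mul_zero] at hr; linarith
    have hya : 0 < y ^ S.α2 := Real.rpow_pos_of_pos hy _
    have hpos : 0 < S.relDec y :=
      lt_of_le_of_ne (S.relDec_nonneg hy (by linarith)) (by
        rw [S.relDec_eq hy (by linarith)]; exact (mul_ne_zero hya.ne' hne).symm)
    refine ⟨hpos, ?_⟩
    have heq : S.relDec (2 * y) = 2 ^ S.α2 * (S.L2 (2 * y) / S.L2 y) * S.relDec y := by
      rw [S.relDec_eq (by linarith) hy2, S.relDec_eq hy (by linarith),
        Real.mul_rpow two_pos.le hy.le]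
      field_simp
    rw [heq]
    exact mul_le_mul_of_nonneg_right hr.le hpos.le
  have hm : 0 < min u (1 / 2) := lt_min hu0 (by norm_num)
  have hm2 : min u (1 / 2) ≤ (1 : ℝ) / 2 := min_le_right _ _
  exact ⟨min u (1 / 2), lam, hm, by linarith, hl1,
    (key _ hm (min_le_left _ _) (by linarith)).1,
    fun y hy hyu hy2 => (key y hy (hyu.trans (min_le_left _ _)) hy2).2⟩

lemma Q2_succ_eq_mul (n : ℕ) : S.Q2 (n + 1) = S.Q2 n * (1 - S.relDec (S.Q2 n)) := by
  have := (S.Q2_pos n).ne'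
  rw [Q2_succ, relDec]
  field_simp
  ring

lemma Q2_antitone : Antitone S.Q2 := antitone_nat_of_succ_le fun n => by
  rw [Q2_succ]; exact S.stepQ2_le (S.Q2_pos n).le (S.Q2_le_one n)

/-- `Q₂` decays at most polynomially. -/
lemma exists_pow_mul_Q2_mono : ∃ p K : ℕ, 1 ≤ K ∧ ∀ j n : ℕ, K ≤ j → j ≤ n →
    (j : ℝ) ^ p * S.Q2 j ≤ (n : ℝ) ^ p * S.Q2 n := by
  obtain ⟨y₀, lam, hy0, hy1, hlam, hpos, hdouble⟩ := S.exists_relDec_double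
  have hsmall : ∃ K, ∀ k, K ≤ k → S.Q2 k ≤ y₀ := by
    by_contra! hcon
    have hall : ∀ k, y₀ ≤ S.Q2 k := fun k => by
      obtain ⟨l, hl, hl'⟩ := hcon k
      exact hl'.le.trans (S.Q2_antitone hl)
    have hdec : ∀ k : ℕ, S.Q2 k ≤ 1 - k * (y₀ * S.relDec y₀) := by
      intro k
      induction k with
      | zero => simp [Q2_zero]
      | succ k ih =>
        have h1 := S.relDec_mono hy0 (hall k) (S.Q2_le_one k)
        have h2 : y₀ * S.relDec y₀ ≤ S.Q2 k * S.relDec (S.Q2 k) :=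
          mul_le_mul (hall k) h1 hpos.le (S.Q2_pos k).le
        rw [Q2_succ_eq_mul]
        push_cast
        linarith
    obtain ⟨N, hN⟩ := exists_nat_gt (1 / (y₀ * S.relDec y₀))
    rw [div_lt_iff₀ (mul_pos hy0 hpos)] at hN
    linarith [hdec N, S.Q2_pos N]
  obtain ⟨C, hC⟩ := exists_mul_relDecrement_le (v := S.Q2) (φ := fun k => S.relDec (S.Q2 k))
    S.Q2_pos (fun k => S.relDec_nonneg (S.Q2_pos k) (S.Q2_le_one k))
    (fun k => by
      have := div_pos (S.stepQ2_pos (S.Q2_pos k) (S.Q2_le_one k)) (S.Q2_pos k)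
      dsimp only [relDec]; linarith)
    S.Q2_succ_eq_mul (fun j k hjk => S.relDec_mono (S.Q2_pos k) (S.Q2_antitone hjk) (S.Q2_le_one j))
    hlam (fun j k hk hjk => (hdouble _ (S.Q2_pos k) hk (hjk.trans (S.Q2_le_one j))).trans
      (S.relDec_mono (by linarith [S.Q2_pos k]) hjk (S.Q2_le_one j))) hsmall
  exact exists_pow_mul_mono S.Q2_pos S.Q2_succ_eq_mul hC

lemma Q2_le_Q21 (n : ℕ) : S.Q2 n ≤ S.Q21 n := by
  rw [Q2_eq, Q21_eq]
  linarith [S.F21_mono n le_rfl zero_le_one le_rfl (le_refl (0 : ℝ)) le_rfl zero_le_one]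

lemma Q21_pos (n : ℕ) : 0 < S.Q21 n := (S.Q2_pos n).trans_le (S.Q2_le_Q21 n)

lemma Q21_le_one (n : ℕ) : S.Q21 n ≤ 1 := by
  rw [Q21_eq]; linarith [S.F21_nonneg n le_rfl (le_refl (0 : ℝ))]

lemma Q1_nonneg (n : ℕ) : 0 ≤ S.Q1 n := ENNReal.toReal_nonneg

lemma Q1_le_one (n : ℕ) : S.Q1 n ≤ 1 := by
  rw [Q1_eq]; linarith [S.F1_nonneg n (le_refl (0 : ℝ))]

lemma Q21_add_le (k j : ℕ) : S.Q21 (k + j) ≤ S.Q2 k + k * S.A21 * S.Q1 j := by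
  have h0 := S.F1_nonneg j (le_refl (0 : ℝ))
  have h1 := S.F1_le_one j le_rfl zero_le_one
  have g0 := S.F21_nonneg j (le_refl (0 : ℝ)) (le_refl (0 : ℝ))
  have g1 := S.F21_le_one j le_rfl zero_le_one le_rfl zero_le_one
  rw [Q21_eq, S.F21_add k j le_rfl zero_le_one le_rfl zero_le_one, Q2_eq, Q1_eq]
  have e1 := S.F21_one_sub_F21_le k h0 h1 g0 g1
  have e2 := S.F21_mono k zero_le_one le_rfl le_rfl le_rfl g0 g1
  linarith

lemma Q2_add (m j : ℕ) : S.Q2 (m + j) = 1 - S.F21 m 1 (1 - S.Q2 j) := by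
  rw [Q2_eq, S.F21_add m j zero_le_one le_rfl le_rfl zero_le_one, F1_one, Q2_eq, sub_sub_cancel]

lemma Ered_eq {m n : ℕ} (hmn : m ≤ n) {s1 s2 : ℝ} (h10 : 0 ≤ s1) (h11 : s1 ≤ 1) (h20 : 0 ≤ s2)
    (h21 : s2 ≤ 1) : S.Ered m n (fun k l => s1 ^ k * s2 ^ l) =
      1 - (1 - S.F21 m (1 - (1 - s1) * S.Q1 (n - m)) (1 - (1 - s2) * S.Q21 (n - m))) /
        S.Q21 n := by
  have hm := S.measurableSet_surv n
  have hint := S.integrable_pow_mul_pow (S.mR1 m n) (S.mR2 m n) h10 h11 h20 h21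
  have hred : ∫ ω, s1 ^ S.R1 m n ω * s2 ^ S.R2 m n ω ∂S.P2 =
      S.F21 m (1 - (1 - s1) * S.Q1 (n - m)) (1 - (1 - s2) * S.Q21 (n - m)) :=
    S.hreduced m n hmn s1 s2 h10 h11 h20 h21
  have hcompl : ∫ ω in (S.surv n)ᶜ, s1 ^ S.R1 m n ω * s2 ^ S.R2 m n ω ∂S.P2 = 1 - S.Q21 n := by
    rw [setIntegral_congr_ae (g := fun _ => (1 : ℝ)) hm.compl]
    · rw [setIntegral_const, smul_eq_mul, mul_one, probReal_compl_eq_one_sub hm]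
      rfl
    · filter_upwards [S.hext m n] with ω h hω
      have hz : S.Z1 n ω = 0 ∧ S.Z2 n ω = 0 := by simpa [surv] using hω
      simp [h hz]
  have hsum := integral_add_compl hm hint
  rw [hred, hcompl] at hsum
  have hQ := (S.Q21_pos n).ne'
  rw [Ered, eq_sub_of_add_eq hsum]
  field_simp
  ring

lemma Q21_div_Q2_tendsto (hA : S.CondA) :
    Tendsto (fun n => S.Q21 n / S.Q2 n) atTop (𝓝 1) := by
  obtain ⟨p, K, hK1, hreg⟩ := S.exists_pow_mul_Q2_mono
  have hratio : ∀ j n : ℕ, K ≤ j → j ≤ n → S.Q2 j / S.Q2 n ≤ ((n : ℝ) / j) ^ p := by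
    intro j n hj hjn
    have hj0 : (0 : ℝ) < j := by exact_mod_cast (by omega : 0 < j)
    rw [div_pow, div_le_div_iff₀ (S.Q2_pos n) (by positivity), mul_comm]
    exact hreg j n hj hjn
  rw [tendsto_order]
  refine ⟨fun a ha => Eventually.of_forall fun n => ha.trans_le
    ((one_le_div (S.Q2_pos n)).2 (S.Q2_le_Q21 n)), fun b hb => ?_⟩
  have hM : Tendsto (fun M : ℕ => (1 / (1 - 1 / (M : ℝ))) ^ p) atTop (𝓝 1) := by
    have h := ((tendsto_one_div_atTop_nhds_zero_nat (𝕜 := ℝ)).const_sub 1).inv₀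
      (by norm_num) |>.pow p
    simpa using h
  obtain ⟨M, hMb, hM2⟩ := ((hM.eventually (gt_mem_nhds hb)).and (eventually_ge_atTop 2)).exists
  have hMpos : 0 < M := by omega
  have hMR : (2 : ℝ) ≤ M := by exact_mod_cast hM2
  have hdiv : Tendsto (fun n : ℕ => n / M) atTop atTop := Nat.tendsto_div_const_atTop hMpos.ne'
  have herr : Tendsto (fun n : ℕ => (1 / (1 - 1 / (M : ℝ))) ^ p + S.A21 * (2 * M) ^ (p + 1) *
      (((n / M : ℕ) : ℝ) * S.Q1 (n / M) / S.Q2 (n / M))) atTop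
      (𝓝 ((1 / (1 - 1 / (M : ℝ))) ^ p + S.A21 * (2 * M) ^ (p + 1) * 0)) :=
    ((hA.comp hdiv).const_mul _).const_add _
  rw [mul_zero, add_zero] at herr
  filter_upwards [herr.eventually (gt_mem_nhds hMb), hdiv.eventually_ge_atTop K,
    eventually_ge_atTop (2 * K)] with n hn hjK hnK
  refine lt_of_le_of_lt ?_ hn
  set j := n / M
  have hjM : j * M ≤ n := Nat.div_mul_le_self n M
  have hnj : n < (j + 1) * M := by
    rw [mul_comm]; exact Nat.lt_mul_div_succ n hMpos
  have hj2 : j ≤ n / 2 := Nat.div_le_div_left hM2 two_pos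
  clear_value j
  obtain ⟨k, rfl⟩ : ∃ k, n = k + j := ⟨n - j, by omega⟩
  have hkK : K ≤ k := by omega
  have hj1 : (1 : ℝ) ≤ j := by exact_mod_cast hK1.trans hjK
  have hk1 : (1 : ℝ) ≤ k := by exact_mod_cast hK1.trans hkK
  have hjMR : (j : ℝ) * M ≤ k + j := by exact_mod_cast hjM
  have hnjR : (k + j : ℝ) ≤ (j + 1) * M := by exact_mod_cast hnj.le
  have hr1 : S.Q2 k / S.Q2 (k + j) ≤ (1 / (1 - 1 / (M : ℝ))) ^ p := by
    refine (hratio k (k + j) hkK (by omega)).trans ?_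
    refine pow_le_pow_left₀ (by positivity) ?_ p
    have hM1 : (0 : ℝ) < 1 - 1 / M := by
      rw [sub_pos, div_lt_one (by linarith)]; linarith
    rw [div_le_div_iff₀ (by linarith) hM1]
    push_cast
    have : (j : ℝ) ≤ (k + j) / M := by rwa [le_div_iff₀ (by linarith)]
    have h2 : (k + j : ℝ) * (1 / M) = (k + j) / M := by ring
    linarith
  have hnj2 : ((k + j : ℕ) : ℝ) / j ≤ 2 * M := by
    rw [div_le_iff₀ (by linarith)]; push_cast; nlinarith
  have hr2 : S.Q2 j / S.Q2 (k + j) ≤ (2 * M) ^ p :=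
    (hratio j (k + j) hjK (by omega)).trans (pow_le_pow_left₀ (by positivity) hnj2 p)
  have hkj : (k : ℝ) / j ≤ 2 * M := by
    refine le_trans ?_ hnj2
    push_cast
    gcongr
    linarith
  have hA0 := S.hA21
  have hQj := S.Q2_pos j
  have hQn := S.Q2_pos (k + j)
  have ha : 0 ≤ (j : ℝ) * S.Q1 j / S.Q2 j := by
    have := S.Q1_nonneg j; positivity
  calc S.Q21 (k + j) / S.Q2 (k + j)
      ≤ (S.Q2 k + k * S.A21 * S.Q1 j) / S.Q2 (k + j) := by
        gcongr; exact S.Q21_add_le k j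
    _ = S.Q2 k / S.Q2 (k + j) + S.A21 * ((S.Q2 j / S.Q2 (k + j)) * (k / j)) *
          (j * S.Q1 j / S.Q2 j) := by
        have : (j : ℝ) ≠ 0 := by linarith
        field_simp
    _ ≤ _ := by
        rw [pow_succ]
        gcongr

lemma Q2_sub_div_Q2_tendsto {m : ℕ → ℕ} (hm : ∀ᶠ n in atTop, m n ≤ n)
    (hmn : Tendsto (fun n : ℕ => (m n : ℝ) / n) atTop (𝓝 0))
    (hsub : Tendsto (fun n => n - m n) atTop atTop) :
    Tendsto (fun n => S.Q2 (n - m n) / S.Q2 n) atTop (𝓝 1) := by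
  obtain ⟨p, K, hK1, hreg⟩ := S.exists_pow_mul_Q2_mono
  have hlim : Tendsto (fun n : ℕ => ((1 - (m n : ℝ) / n)⁻¹) ^ p) atTop (𝓝 1) := by
    simpa using ((hmn.const_sub 1).inv₀ (by norm_num)).pow p
  refine tendsto_of_tendsto_of_tendsto_of_le_of_le' tendsto_const_nhds hlim
    (Eventually.of_forall fun n =>
      (one_le_div (S.Q2_pos n)).2 (S.Q2_antitone (Nat.sub_le n (m n)))) ?_
  filter_upwards [hm, hsub.eventually_ge_atTop K] with n hn hnK
  have hd0 : (0 : ℝ) < ((n - m n : ℕ) : ℝ) := by exact_mod_cast (by omega : 0 < n - m n)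
  have hn0 : (0 : ℝ) < n := by exact_mod_cast (by omega : 0 < n)
  have heq : (1 - (m n : ℝ) / n)⁻¹ = n / ((n - m n : ℕ) : ℝ) := by
    rw [Nat.cast_sub hn, one_sub_div hn0.ne', inv_div]
  rw [heq, div_pow, div_le_div_iff₀ (S.Q2_pos n) (by positivity), mul_comm]
  exact hreg _ _ hnK (Nat.sub_le _ _)

end GWSetup

/-- Theorem `T_ZubQ1`(0).  Under Condition (A)
(`n Q₁(n) = o(Q₂(n))`), for any `s₁, s₂ ∈ (0,1)` and any integer sequence
`m = m(n)` with `1 ≤ m(n)` and `m(n)/n → 0`,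
`E[s₁^{Z₁(m,n)} s₂^{Z₂(m,n)} | Z(n) ≠ 0, Z(0) = e₂] → s₂`. -/
theorem condA_early_reduced_pgf (S : GWSetup) (hA : S.CondA)
    (s1 s2 : ℝ) (hs1 : s1 ∈ Set.Ioo (0 : ℝ) 1) (hs2 : s2 ∈ Set.Ioo (0 : ℝ) 1)
    (m : ℕ → ℕ) (hm1 : ∀ n, 1 ≤ m n)
    (hmn : Filter.Tendsto (fun n : ℕ => (m n : ℝ) / (n : ℝ)) Filter.atTop (nhds 0)) :
    Filter.Tendsto (fun n : ℕ => S.Ered (m n) n (fun k l => s1 ^ k * s2 ^ l))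
      Filter.atTop (nhds s2) := by
  have hhalf : ∀ᶠ n : ℕ in atTop, 2 * m n ≤ n := by
    filter_upwards [hmn.eventually (gt_mem_nhds (show (0 : ℝ) < 1 / 2 by norm_num)),
      eventually_gt_atTop 0] with n hn hn0
    have hn0' : (0 : ℝ) < n := by exact_mod_cast hn0
    rw [div_lt_iff₀ hn0'] at hn
    have : (2 * m n : ℝ) ≤ n := by linarith
    exact_mod_cast this
  have hsub : Tendsto (fun n => n - m n) atTop atTop := by
    refine tendsto_atTop_mono' atTop ?_ (Nat.tendsto_div_const_atTop two_ne_zero)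
    filter_upwards [hhalf] with n hn
    omega
  have hq := S.Q2_sub_div_Q2_tendsto (hhalf.mono fun n hn => by omega) hmn hsub
  have hr := S.Q21_div_Q2_tendsto hA
  have hlow : Tendsto (fun n => 1 - ((1 - s2) * (S.Q21 (n - m n) / S.Q2 (n - m n)) *
      (S.Q2 (n - m n) / S.Q2 n) + S.A21 * (((n - m n : ℕ) : ℝ) * S.Q1 (n - m n) /
        S.Q2 (n - m n)) * (S.Q2 (n - m n) / S.Q2 n))) atTop (𝓝 s2) := by
    have h := ((((hr.comp hsub).const_mul (1 - s2)).mul hq).add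
      (((hA.comp hsub).const_mul S.A21).mul hq)).const_sub 1
    simpa using h
  have hup : Tendsto (fun n => 1 - (1 - s2) * (S.Q21 n / S.Q2 n)⁻¹) atTop (𝓝 s2) := by
    simpa using ((hr.inv₀ one_ne_zero).const_mul (1 - s2)).const_sub 1
  obtain ⟨h10, h11⟩ := hs1
  obtain ⟨h20, h21⟩ := hs2
  refine tendsto_of_tendsto_of_tendsto_of_le_of_le' hlow hup ?_ ?_
  all_goals
    filter_upwards [hhalf] with n hn
    obtain ⟨j, hj⟩ : ∃ j, n = m n + j := ⟨n - m n, by omega⟩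
    have hnj : n - m n = j := by omega
    rw [S.Ered_eq (by omega) h10.le h11.le h20.le h21.le, hnj]
    have hQn := S.Q2_pos n
    have hQ21n := S.Q21_pos n
    have hQle := S.Q2_le_Q21 n
    have hQj := S.Q2_pos j
    have hx0 := mul_nonneg (sub_nonneg.2 h11.le) (S.Q1_nonneg j)
    have hx1 : (1 - s1) * S.Q1 j ≤ S.Q1 j := by nlinarith [S.Q1_nonneg j]
    have hQ1 := S.Q1_le_one j
    have hy0 := mul_nonneg (sub_nonneg.2 h21.le) (S.Q21_pos j).le
    have hy1 : (1 - s2) * S.Q21 j ≤ S.Q21 j := by nlinarith [S.Q21_pos j]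
    have hQ21j := S.Q21_le_one j
  · refine sub_le_sub_left ?_ 1
    have e1 := S.F21_one_sub_F21_le (m n) (s := 1 - (1 - s1) * S.Q1 j)
      (t := 1 - (1 - s2) * S.Q21 j) (by linarith) (by linarith) (by linarith) (by linarith)
    have e2 := S.le_F21_one (m n) (t := 1 - (1 - s2) * S.Q21 j) (by linarith) (by linarith)
    have hmj : (m n : ℝ) ≤ j := by exact_mod_cast (by omega : m n ≤ j)
    have hA0 := S.hA21
    have e3 : (m n : ℝ) * S.A21 * ((1 - s1) * S.Q1 j) ≤ j * S.A21 * S.Q1 j := by gcongr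
    have hnum : 1 - S.F21 (m n) (1 - (1 - s1) * S.Q1 j) (1 - (1 - s2) * S.Q21 j) ≤
        (1 - s2) * S.Q21 j + j * S.A21 * S.Q1 j := by linarith
    have hrhs : 0 ≤ (1 - s2) * S.Q21 j + j * S.A21 * S.Q1 j := by
      have := S.Q1_nonneg j
      positivity
    calc _ ≤ ((1 - s2) * S.Q21 j + j * S.A21 * S.Q1 j) / S.Q21 n := by gcongr
      _ ≤ ((1 - s2) * S.Q21 j + j * S.A21 * S.Q1 j) / S.Q2 n := by gcongr
      _ = _ := by field_simp
  · refine sub_le_sub_left ?_ 1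
    rw [inv_div, ← mul_div_assoc]
    have e1 := S.F21_mono (m n) (s := 1 - (1 - s1) * S.Q1 j) (s' := 1)
      (t := 1 - (1 - s2) * S.Q21 j) (t' := 1 - (1 - s2) * S.Q2 j) (by linarith) (by linarith)
      le_rfl (by linarith) (by nlinarith [S.Q2_le_Q21 j]) (by nlinarith)
    have e2 := S.F21_one_convex (m n) (c := 1 - s2) (t := 1 - S.Q2 j) (by linarith) (by linarith)
      (by linarith [S.Q2_le_one j]) (by linarith)
    rw [sub_sub_cancel] at e2
    have e3 := S.Q2_add (m n) j
    rw [← hj] at e3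
    rw [← e3] at e2
    gcongr
    linarith
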